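/- arXiv:1605.08084 — 2 statements merged into one kernel-verified Lean document; each statement's English description precedes it below -/
import Mathlib

section
/- Let T > 0, b ∈ ℝ, let u : [0,T) × ℝ → ℝ be continuous, continuously differentiable in x, with u and ∂_x u bounded on [0,t'] × ℝ for every t' < T, let φ be its flow with ∂_x φ(t,x) = exp(∫₀^t ∂_x u(s, φ(s,x)) ds) > 0 and with x ↦ φ(t,x) a bijection of ℝ for each t, and let ρ : [0,T) × ℝ → ℝ be a continuously differentiable solution of ∂_t ρ + u ∂_x ρ + (b−1)(∂_x u) ρ = 0 with ρ(0,·) = ρ₀. Then for all t ∈ [0,T) and all x ∈ ℝ, denoting by φ(t,·)^{-1} the inverse of the map y ↦ φ(t,y), one has the representation ρ(t,x) = ρ₀(φ(t,·)^{-1}(x)) · (∂_x φ(t, φ(t,·)^{-1}(x)))^{1−b}. -/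
lemma aux_mvt (f f' : ℝ → ℝ) (hf : ∀ x, HasDerivAt f (f' x) x) (a c : ℝ) :
    ∃ ξ, |ξ - a| ≤ |c - a| ∧ f c - f a = f' ξ * (c - a) := by
  rcases lt_trichotomy a c with h | h | h
  · obtain ⟨ξ, hξ, h2⟩ := exists_hasDerivAt_eq_slope f f' h
      (fun x _ => (hf x).continuousAt.continuousWithinAt) (fun x _ => hf x)
    refine ⟨ξ, ?_, ?_⟩
    · rw [abs_of_pos (sub_pos.2 hξ.1), abs_of_pos (sub_pos.2 h)]
      linarith [hξ.2]
    · rw [h2, div_mul_cancel₀ _ (sub_pos.2 h).ne']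
  · exact ⟨a, by simp, by simp [h]⟩
  · obtain ⟨ξ, hξ, h2⟩ := exists_hasDerivAt_eq_slope f f' h
      (fun x _ => (hf x).continuousAt.continuousWithinAt) (fun x _ => hf x)
    refine ⟨ξ, ?_, ?_⟩
    · rw [abs_of_neg (sub_neg.2 hξ.2), abs_of_neg (sub_neg.2 h)]
      linarith [hξ.1]
    · rw [h2, div_mul_eq_mul_div, eq_div_iff (sub_pos.2 h).ne']
      ring

lemma aux_chain (S : Set ℝ) (ρ ρx : ℝ → ℝ → ℝ) (X : ℝ → ℝ) (s r v : ℝ) (hs : s ∈ S)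
    (hρt : HasDerivWithinAt (fun σ => ρ σ (X s)) r S s)
    (hρx : ∀ t ∈ S, ∀ x : ℝ, HasDerivAt (ρ t) (ρx t x) x)
    (hc : ContinuousOn (fun q : ℝ × ℝ => ρx q.1 q.2) (S ×ˢ (Set.univ : Set ℝ)))
    (hX : HasDerivWithinAt X v S s) :
    HasDerivWithinAt (fun σ => ρ σ (X σ)) (ρx s (X s) * v + r) S s := by
  have hex : ∀ σ, ∃ ξ, |ξ - X s| ≤ |X σ - X s| ∧
      (σ ∈ S → ρ σ (X σ) - ρ σ (X s) = ρx σ ξ * (X σ - X s)) := by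
    intro σ
    by_cases h : σ ∈ S
    · obtain ⟨ξ, h1, h2⟩ := aux_mvt (ρ σ) (ρx σ) (hρx σ h) (X s) (X σ)
      exact ⟨ξ, h1, fun _ => h2⟩
    · exact ⟨X s, by simp, fun h' => absurd h' h⟩
  choose ξ hξ1 hξ2 using hex
  have hle : nhdsWithin s (S \ {s}) ≤ nhdsWithin s S := nhdsWithin_mono _ Set.sdiff_subset
  have hXc : Filter.Tendsto X (nhdsWithin s S) (nhds (X s)) := hX.continuousWithinAt
  have hξt : Filter.Tendsto ξ (nhdsWithin s S) (nhds (X s)) := by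
    rw [tendsto_iff_norm_sub_tendsto_zero] at hXc ⊢
    exact squeeze_zero (fun _ => norm_nonneg _) hξ1 hXc
  have hk : Filter.Tendsto (fun σ => ρx σ (ξ σ)) (nhdsWithin s S) (nhds (ρx s (X s))) := by
    have h1 := hc (s, X s) ⟨hs, trivial⟩
    have h2 : Filter.Tendsto (fun σ => (σ, ξ σ)) (nhdsWithin s S)
        (nhdsWithin (s, X s) (S ×ˢ (Set.univ : Set ℝ))) := by
      apply tendsto_nhdsWithin_iff.2
      refine ⟨(tendsto_nhdsWithin_of_tendsto_nhds Filter.tendsto_id).prodMk_nhds hξt, ?_⟩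
      filter_upwards [self_mem_nhdsWithin] with σ hσ
      exact ⟨hσ, trivial⟩
    exact Filter.Tendsto.comp h1 h2
  rw [hasDerivWithinAt_iff_tendsto_slope] at hρt hX ⊢
  refine (((hk.mono_left hle).mul hX).add hρt).congr' ?_
  filter_upwards [self_mem_nhdsWithin] with σ hσ
  have := hξ2 σ hσ.1
  simp only [slope_def_field]
  rw [← mul_div_assoc, ← this, ← add_div]
  congr 1
  ring

/-- Representation formula: if `ρ` is a `C¹` solution of the transport
equation `∂_t ρ + u ∂_x ρ + (b-1)(∂_x u) ρ = 0` along the flow `φ` of `u` (each `φ(t,·)`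
a bijection of `ℝ`), then
`ρ(t,x) = ρ₀(φ(t,·)⁻¹(x)) · (∂_x φ(t, φ(t,·)⁻¹(x)))^{1-b}` on `[0,T) × ℝ`,
where `∂_x φ(t,y) = exp(∫₀^t ∂_x u(s,φ(s,y)) ds)`. -/
theorem stmt4 (T b : ℝ) (hT : 0 < T)
    (u ux : ℝ → ℝ → ℝ)
    (hu_cont : ContinuousOn (fun q : ℝ × ℝ => u q.1 q.2)
      (Set.Ico 0 T ×ˢ (Set.univ : Set ℝ)))
    (hux_cont : ContinuousOn (fun q : ℝ × ℝ => ux q.1 q.2)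
      (Set.Ico 0 T ×ˢ (Set.univ : Set ℝ)))
    (hux : ∀ t ∈ Set.Ico (0 : ℝ) T, ∀ x : ℝ, HasDerivAt (u t) (ux t x) x)
    (hbdd : ∀ t' ∈ Set.Ico (0 : ℝ) T, ∃ M : ℝ,
      ∀ t ∈ Set.Icc (0 : ℝ) t', ∀ x : ℝ, |u t x| ≤ M ∧ |ux t x| ≤ M)
    -- φ is the C¹ flow of u, each φ(t,·) a bijection
    (φ : ℝ → ℝ → ℝ)
    (hφC1 : ContDiffOn ℝ 1 (fun q : ℝ × ℝ => φ q.1 q.2) (Set.Ico 0 T ×ˢ (Set.univ : Set ℝ)))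
    (hφ0 : ∀ x : ℝ, φ 0 x = x)
    (hφt : ∀ t ∈ Set.Ico (0 : ℝ) T, ∀ x : ℝ,
      HasDerivWithinAt (fun s => φ s x) (u t (φ t x)) (Set.Ico 0 T) t)
    (hφx : ∀ t ∈ Set.Ico (0 : ℝ) T, ∀ x : ℝ,
      HasDerivAt (φ t) (Real.exp (∫ s in (0 : ℝ)..t, ux s (φ s x))) x)
    (hφbij : ∀ t ∈ Set.Ico (0 : ℝ) T, Function.Bijective (φ t))
    -- ρ is a C¹ solution of the transport equation with data ρ₀
    (ρ ρt ρx : ℝ → ℝ → ℝ) (ρ₀ : ℝ → ℝ)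
    (hρ0 : ∀ x : ℝ, ρ 0 x = ρ₀ x)
    (hρt : ∀ t ∈ Set.Ico (0 : ℝ) T, ∀ x : ℝ,
      HasDerivWithinAt (fun s => ρ s x) (ρt t x) (Set.Ico 0 T) t)
    (hρx : ∀ t ∈ Set.Ico (0 : ℝ) T, ∀ x : ℝ, HasDerivAt (ρ t) (ρx t x) x)
    (hρt_cont : ContinuousOn (fun q : ℝ × ℝ => ρt q.1 q.2)
      (Set.Ico 0 T ×ˢ (Set.univ : Set ℝ)))
    (hρx_cont : ContinuousOn (fun q : ℝ × ℝ => ρx q.1 q.2)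
      (Set.Ico 0 T ×ˢ (Set.univ : Set ℝ)))
    (heq : ∀ t ∈ Set.Ico (0 : ℝ) T, ∀ x : ℝ,
      ρt t x + u t x * ρx t x + (b - 1) * ux t x * ρ t x = 0) :
    ∀ t ∈ Set.Ico (0 : ℝ) T, ∀ x : ℝ,
      ρ t x = ρ₀ (Function.invFun (φ t) x) *
        (Real.exp (∫ s in (0 : ℝ)..t, ux s (φ s (Function.invFun (φ t) x)))) ^ (1 - b) := by
  intro t ht x
  obtain ⟨y, hy⟩ : ∃ y, y = Function.invFun (φ t) x := ⟨_, rfl⟩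
  have hyx : φ t y = x := by
    rw [hy]; exact Function.rightInverse_invFun (hφbij t ht).2 x
  rw [← hy]
  have hkc : ContinuousOn (fun s => ux s (φ s y)) (Set.Ico 0 T) := by
    have h1 : ContinuousOn (fun s => (s, φ s y)) (Set.Ico 0 T) :=
      continuousOn_id.prodMk (fun s hs => (hφt s hs y).continuousWithinAt)
    exact hux_cont.comp h1 (fun s hs => ⟨hs, trivial⟩)
  have hsub : Set.Icc 0 t ⊆ Set.Ico 0 T := fun s hs => ⟨hs.1, hs.2.trans_lt ht.2⟩
  obtain ⟨k, hkdef⟩ : ∃ k : ℝ → ℝ,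
    k = Set.IccExtend ht.1 ((Set.Icc 0 t).restrict (fun s => ux s (φ s y))) := ⟨_, rfl⟩
  have hk : Continuous k := by
    rw [hkdef]
    exact (continuousOn_iff_continuous_restrict.1 (hkc.mono hsub)).Icc_extend'
  have hkeq : ∀ s ∈ Set.Icc 0 t, k s = ux s (φ s y) := by
    intro s hs
    rw [hkdef, Set.IccExtend_of_mem _ _ hs]; rfl
  have hint : ∫ s in (0 : ℝ)..t, ux s (φ s y) = ∫ s in (0 : ℝ)..t, k s := by
    apply intervalIntegral.integral_congr
    intro s hs
    rw [Set.uIcc_of_le ht.1] at hs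
    exact (hkeq s hs).symm
  have hK : ∀ s, HasDerivAt (fun s => ∫ σ in (0 : ℝ)..s, k σ) (k s) s := fun s =>
    intervalIntegral.integral_hasDerivAt_right (hk.intervalIntegrable _ _)
      (hk.stronglyMeasurableAtFilter _ _) hk.continuousAt
  have hg : ∀ s ∈ Set.Icc 0 t, HasDerivWithinAt
      (fun s => ρ s (φ s y) * Real.exp ((b - 1) * ∫ σ in (0 : ℝ)..s, k σ)) 0 (Set.Ico 0 T) s := by
    intro s hs
    have h1 := aux_chain (Set.Ico 0 T) ρ ρx (fun s => φ s y) s _ _ (hsub hs)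
      (hρt s (hsub hs) (φ s y)) hρx hρx_cont (hφt s (hsub hs) y)
    have h2 := (((hK s).const_mul (b - 1)).exp).hasDerivWithinAt (s := Set.Ico 0 T)
    have h3 := h1.mul h2
    refine h3.congr_deriv ?_
    rw [hkeq s hs]
    have := heq s (hsub hs) (φ s y)
    linear_combination (Real.exp ((b - 1) * ∫ σ in (0 : ℝ)..s, k σ)) * this
  have hconst := constant_of_has_deriv_right_zero
    (fun s hs => ((hg s hs).continuousWithinAt).mono hsub)
    (fun s hs => (hg s ⟨hs.1, hs.2.le⟩).mono_of_mem_nhdsWithin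
      (Filter.mem_of_superset (Ico_mem_nhdsGE (hs.2.trans ht.2))
        (Set.Ico_subset_Ico_left hs.1))) t ⟨ht.1, le_rfl⟩
  simp only [intervalIntegral.integral_same, mul_zero, Real.exp_zero, mul_one, hφ0, hρ0, hyx]
    at hconst
  rw [hint, ← hconst, ← Real.exp_mul, mul_assoc, ← Real.exp_add]
  have : (b - 1) * (∫ σ in (0 : ℝ)..t, k σ) + (∫ σ in (0 : ℝ)..t, k σ) * (1 - b) = 0 := by ring
  rw [this, Real.exp_zero, mul_one]
end

section
/- Let T > 0, b, κ ∈ ℝ, let u : [0,T) × ℝ → ℝ be continuous, continuously differentiable in x, with u and ∂_x u bounded on [0,t'] × ℝ for every t' < T, and let φ be its flow with ∂_x φ(t,x) = exp(∫₀^t ∂_x u(s, φ(s,x)) ds) > 0. Let ρ, m : [0,T) × ℝ → ℝ be continuously differentiable, with ρ solving ∂_t ρ + u ∂_x ρ + (b−1)(∂_x u) ρ = 0 and m solving ∂_t m + u ∂_x m + b (∂_x u) m + κ ρ ∂_x ρ = 0 on [0,T) × ℝ, with m(0,·) = m₀. Then for all (t,x) ∈ [0,T) × ℝ: m(t, φ(t,x))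 · (∂_x φ(t,x))^{b} = m₀(x) − κ ∫₀^t ρ(s, φ(s,x)) ∂_x ρ(s, φ(s,x)) (∂_x φ(s,x))^{b} ds. -/
open Set Filter Topology in
theorem chain_aux (T : ℝ) (f fx : ℝ → ℝ → ℝ) (γ : ℝ → ℝ) (t a g' : ℝ)
    (ht : t ∈ Ico 0 T)
    (hft : HasDerivWithinAt (fun s => f s (γ t)) a (Ico 0 T) t)
    (hfx : ∀ t ∈ Ico (0 : ℝ) T, ∀ x : ℝ, HasDerivAt (f t) (fx t x) x)
    (hfx_cont : ContinuousOn (fun q : ℝ × ℝ => fx q.1 q.2) (Ico 0 T ×ˢ (univ : Set ℝ)))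
    (hγ : HasDerivWithinAt γ g' (Ico 0 T) t) :
    HasDerivWithinAt (fun s => f s (γ s)) (a + g' * fx t (γ t)) (Ico 0 T) t := by
  have key : ∀ s : ℝ, ∃ c : ℝ, |c - γ t| ≤ |γ s - γ t| ∧
      (s ∈ Ico 0 T → f s (γ s) - f s (γ t) = (γ s - γ t) * fx s c) := by
    intro s
    by_cases hs : s ∈ Ico 0 T
    · rcases lt_trichotomy (γ s) (γ t) with h | h | h
      · obtain ⟨c, hc, e⟩ := exists_hasDerivAt_eq_slope (f s) (fx s) h
          (fun x _ => (hfx s hs x).continuousAt.continuousWithinAt) (fun x _ => hfx s hs x)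
        refine ⟨c, ?_, fun _ => ?_⟩
        · rw [abs_of_nonpos, abs_of_nonpos] <;> linarith [hc.1, hc.2]
        · have : γ t - γ s ≠ 0 := by linarith
          rw [e]; field_simp; ring
      · exact ⟨γ t, by simp, fun _ => by simp [h]⟩
      · obtain ⟨c, hc, e⟩ := exists_hasDerivAt_eq_slope (f s) (fx s) h
          (fun x _ => (hfx s hs x).continuousAt.continuousWithinAt) (fun x _ => hfx s hs x)
        refine ⟨c, ?_, fun _ => ?_⟩
        · rw [abs_of_nonneg, abs_of_nonneg] <;> linarith [hc.1, hc.2]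
        · have : γ s - γ t ≠ 0 := by linarith
          rw [e]; field_simp
    · exact ⟨γ t, by simp, fun h => absurd h hs⟩
  choose c hc1 hc2 using key
  have hγc : Tendsto γ (𝓝[Ico 0 T] t) (𝓝 (γ t)) := hγ.continuousWithinAt
  have hcT : Tendsto c (𝓝[Ico 0 T] t) (𝓝 (γ t)) := by
    rw [tendsto_iff_dist_tendsto_zero] at hγc ⊢
    refine squeeze_zero (fun _ => dist_nonneg) (fun s => ?_) hγc
    simpa [Real.dist_eq] using hc1 s
  have hpair : Tendsto (fun s => (s, c s)) (𝓝[Ico 0 T] t)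
      (𝓝[Ico 0 T ×ˢ (univ : Set ℝ)] (t, γ t)) := by
    refine tendsto_nhdsWithin_iff.2 ⟨?_, ?_⟩
    · exact (tendsto_nhdsWithin_of_tendsto_nhds tendsto_id).prodMk_nhds hcT
    · filter_upwards [self_mem_nhdsWithin] with s hs using ⟨hs, mem_univ _⟩
  have hfc : Tendsto (fun s => fx s (c s)) (𝓝[Ico 0 T] t) (𝓝 (fx t (γ t))) :=
    (hfx_cont (t, γ t) ⟨ht, mem_univ _⟩).tendsto.comp hpair
  rw [hasDerivWithinAt_iff_tendsto_slope] at *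
  have hfc' := hfc.mono_left (nhdsWithin_mono t (diff_subset : Ico 0 T \ {t} ⊆ Ico 0 T))
  refine (hft.add (hγ.mul hfc')).congr' ?_
  filter_upwards [self_mem_nhdsWithin] with s hs
  have := hc2 s hs.1
  simp only [slope_def_field]
  rw [show f s (γ s) - f t (γ t) = (f s (γ t) - f t (γ t)) + (γ s - γ t) * fx s (c s) by
    rw [← this]; ring]
  ring

/-- Along the flow `φ` of `u`, a `C¹` solution `m` of
`∂_t m + u ∂_x m + b (∂_x u) m + κ ρ ∂_x ρ = 0` (with `ρ` solving the transport equation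
`∂_t ρ + u ∂_x ρ + (b-1)(∂_x u) ρ = 0`) satisfies
`m(t,φ(t,x)) (∂_x φ(t,x))^b = m₀(x) - κ ∫₀^t ρ(s,φ(s,x)) ∂_x ρ(s,φ(s,x)) (∂_x φ(s,x))^b ds`,
where `∂_x φ(t,x) = exp(∫₀^t ∂_x u(s,φ(s,x)) ds) > 0`. -/
theorem stmt6 (T b κ : ℝ) (hT : 0 < T)
    (u ux : ℝ → ℝ → ℝ)
    (hu_cont : ContinuousOn (fun q : ℝ × ℝ => u q.1 q.2)
      (Set.Ico 0 T ×ˢ (Set.univ : Set ℝ)))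
    (hux_cont : ContinuousOn (fun q : ℝ × ℝ => ux q.1 q.2)
      (Set.Ico 0 T ×ˢ (Set.univ : Set ℝ)))
    (hux : ∀ t ∈ Set.Ico (0 : ℝ) T, ∀ x : ℝ, HasDerivAt (u t) (ux t x) x)
    (hbdd : ∀ t' ∈ Set.Ico (0 : ℝ) T, ∃ M : ℝ,
      ∀ t ∈ Set.Icc (0 : ℝ) t', ∀ x : ℝ, |u t x| ≤ M ∧ |ux t x| ≤ M)
    -- φ is the C¹ flow of u
    (φ : ℝ → ℝ → ℝ)
    (hφC1 : ContDiffOn ℝ 1 (fun q : ℝ × ℝ => φ q.1 q.2) (Set.Ico 0 T ×ˢ (Set.univ : Set ℝ)))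
    (hφ0 : ∀ x : ℝ, φ 0 x = x)
    (hφt : ∀ t ∈ Set.Ico (0 : ℝ) T, ∀ x : ℝ,
      HasDerivWithinAt (fun s => φ s x) (u t (φ t x)) (Set.Ico 0 T) t)
    (hφx : ∀ t ∈ Set.Ico (0 : ℝ) T, ∀ x : ℝ,
      HasDerivAt (φ t) (Real.exp (∫ s in (0 : ℝ)..t, ux s (φ s x))) x)
    -- ρ is a C¹ solution of the transport equation
    (ρ ρt ρx : ℝ → ℝ → ℝ)
    (hρt : ∀ t ∈ Set.Ico (0 : ℝ) T, ∀ x : ℝ,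
      HasDerivWithinAt (fun s => ρ s x) (ρt t x) (Set.Ico 0 T) t)
    (hρx : ∀ t ∈ Set.Ico (0 : ℝ) T, ∀ x : ℝ, HasDerivAt (ρ t) (ρx t x) x)
    (hρt_cont : ContinuousOn (fun q : ℝ × ℝ => ρt q.1 q.2)
      (Set.Ico 0 T ×ˢ (Set.univ : Set ℝ)))
    (hρx_cont : ContinuousOn (fun q : ℝ × ℝ => ρx q.1 q.2)
      (Set.Ico 0 T ×ˢ (Set.univ : Set ℝ)))
    (hρeq : ∀ t ∈ Set.Ico (0 : ℝ) T, ∀ x : ℝ,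
      ρt t x + u t x * ρx t x + (b - 1) * ux t x * ρ t x = 0)
    -- m is a C¹ solution of the m-equation with data m₀
    (m mt mx : ℝ → ℝ → ℝ) (m₀ : ℝ → ℝ)
    (hm0 : ∀ x : ℝ, m 0 x = m₀ x)
    (hmt : ∀ t ∈ Set.Ico (0 : ℝ) T, ∀ x : ℝ,
      HasDerivWithinAt (fun s => m s x) (mt t x) (Set.Ico 0 T) t)
    (hmx : ∀ t ∈ Set.Ico (0 : ℝ) T, ∀ x : ℝ, HasDerivAt (m t) (mx t x) x)
    (hmt_cont : ContinuousOn (fun q : ℝ × ℝ => mt q.1 q.2)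
      (Set.Ico 0 T ×ˢ (Set.univ : Set ℝ)))
    (hmx_cont : ContinuousOn (fun q : ℝ × ℝ => mx q.1 q.2)
      (Set.Ico 0 T ×ˢ (Set.univ : Set ℝ)))
    (hmeq : ∀ t ∈ Set.Ico (0 : ℝ) T, ∀ x : ℝ,
      mt t x + u t x * mx t x + b * ux t x * m t x + κ * ρ t x * ρx t x = 0) :
    ∀ t ∈ Set.Ico (0 : ℝ) T, ∀ x : ℝ,
      m t (φ t x) * (Real.exp (∫ s in (0 : ℝ)..t, ux s (φ s x))) ^ b =
        m₀ x - κ * ∫ s in (0 : ℝ)..t,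
          ρ s (φ s x) * ρx s (φ s x) *
            (Real.exp (∫ τ in (0 : ℝ)..s, ux τ (φ τ x))) ^ b := by
  intro t ht x
  have hsub : Set.Icc 0 t ⊆ Set.Ico 0 T := fun s hs => ⟨hs.1, hs.2.trans_lt ht.2⟩
  have hφc : ContinuousOn (fun s => φ s x) (Set.Ico 0 T) :=
    fun s hs => (hφt s hs x).continuousWithinAt
  have hpath : ContinuousOn (fun s => (s, φ s x)) (Set.Ico 0 T) := continuousOn_id.prodMk hφc
  have hmaps : Set.MapsTo (fun s => (s, φ s x)) (Set.Ico 0 T)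
      (Set.Ico 0 T ×ˢ (Set.univ : Set ℝ)) := fun s hs => ⟨hs, Set.mem_univ _⟩
  have huxc : ContinuousOn (fun s => ux s (φ s x)) (Set.Ico 0 T) := hux_cont.comp hpath hmaps
  have hρxc : ContinuousOn (fun s => ρx s (φ s x)) (Set.Ico 0 T) := hρx_cont.comp hpath hmaps
  have hρc : ContinuousOn (fun s => ρ s (φ s x)) (Set.Ico 0 T) := fun s hs =>
    (chain_aux T ρ ρx (fun s => φ s x) s _ _ hs (hρt s hs _) hρx hρx_cont
      (hφt s hs x)).continuousWithinAt
  have hmd := fun s (hs : s ∈ Set.Ico 0 T) =>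
    chain_aux T m mx (fun s => φ s x) s _ _ hs (hmt s hs _) hmx hmx_cont (hφt s hs x)
  have hmc : ContinuousOn (fun s => m s (φ s x)) (Set.Ico 0 T) := fun s hs =>
    (hmd s hs).continuousWithinAt
  have hAc : ContinuousOn (fun s => ∫ τ in (0 : ℝ)..s, ux τ (φ τ x)) (Set.Icc 0 t) := by
    have := intervalIntegral.continuousOn_primitive_interval
      (μ := MeasureTheory.volume) (a := 0) (b := t) (f := fun s => ux s (φ s x))
      (by rw [Set.uIcc_of_le ht.1]; exact (huxc.mono hsub).integrableOn_Icc)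
    rwa [Set.uIcc_of_le ht.1] at this
  have hAd : ∀ s ∈ Set.Ioo 0 t,
      HasDerivAt (fun s => ∫ τ in (0 : ℝ)..s, ux τ (φ τ x)) (ux s (φ s x)) s := by
    intro s hs
    have hsT : s ∈ Set.Ioo 0 T := ⟨hs.1, hs.2.trans ht.2⟩
    apply intervalIntegral.integral_hasDerivAt_right
    · apply ContinuousOn.intervalIntegrable
      rw [Set.uIcc_of_le hs.1.le]
      exact huxc.mono fun r hr => ⟨hr.1, hr.2.trans_lt hsT.2⟩
    · exact (huxc.mono Set.Ioo_subset_Ico_self).stronglyMeasurableAtFilter isOpen_Ioo s hsT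
    · exact huxc.continuousAt (Ico_mem_nhds hsT.1 hsT.2)
  simp only [← Real.exp_mul]
  have hEc := (hAc.mul (continuousOn_const (c := b))).rexp
  have hint : ContinuousOn (fun s => ρ s (φ s x) * ρx s (φ s x) *
      Real.exp ((∫ τ in (0 : ℝ)..s, ux τ (φ τ x)) * b)) (Set.Icc 0 t) :=
    ((hρc.mono hsub).mul (hρxc.mono hsub)).mul hEc
  have main := intervalIntegral.integral_eq_sub_of_hasDerivAt_of_le
    (f := fun s => m s (φ s x) * Real.exp ((∫ τ in (0 : ℝ)..s, ux τ (φ τ x)) * b))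
    (f' := fun s => -κ * (ρ s (φ s x) * ρx s (φ s x) *
      Real.exp ((∫ τ in (0 : ℝ)..s, ux τ (φ τ x)) * b))) ht.1
    ((hmc.mono hsub).mul hEc) ?_ ?_
  · rw [intervalIntegral.integral_const_mul] at main
    simp only [intervalIntegral.integral_same, zero_mul, Real.exp_zero, mul_one, hφ0, hm0] at main
    linarith
  · intro s hs
    have hsT : s ∈ Set.Ico 0 T := hsub ⟨hs.1.le, hs.2.le⟩
    have h1 := (hmd s hsT).hasDerivAt (Ico_mem_nhds hs.1 (hs.2.trans ht.2))
    have h2 := h1.mul ((hAd s hs).mul_const b).exp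
    refine h2.congr_deriv ?_
    linear_combination (Real.exp ((∫ τ in (0 : ℝ)..s, ux τ (φ τ x)) * b)) * hmeq s hsT (φ s x)
  · apply ContinuousOn.intervalIntegrable
    rw [Set.uIcc_of_le ht.1]
    exact continuousOn_const.mul hint
end
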